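/- Let n = 3 and let Pf ∈ MvPolynomial (ι(3)) ℂ be a Pfaffian polynomial, so Pf * Pf = det (G(3)) with 15 variables. Then for every skew-symmetric A : Matrix (Fin 6) (Fin 6) ℂ, all partial derivatives of Pf vanish at A (i.e. for every v ∈ ι(3), the evaluation of pderiv v Pf at the point ⟨i,j⟩ ↦ A i j is 0) if and only if A.rank ≤ 2. That is, the scheme-theoretic singular locus X = {dPf = 0} of the Pfaffian hypersurface is, as a set, the cone over the Grassmannian Gr(2,6), the locus of skew-symmetric matrices of rank at most 2. -/

import Mathlib

open Matrix MvPolynomial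

/-- Index type for the entries of a skew-symmetric `2n × 2n` matrix (entries above
the diagonal): pairs `(i, j)` with `i < j`. -/
def SkewIdx (n : ℕ) : Type :=
  {p : Fin (2 * n) × Fin (2 * n) // p.1 < p.2}

/-- The generic skew-symmetric `2n × 2n` matrix. -/
noncomputable def genSkew (n : ℕ) :
    Matrix (Fin (2 * n)) (Fin (2 * n)) (MvPolynomial (SkewIdx n) ℂ) :=
  fun i j =>
    if h : i < j then X ⟨(i, j), h⟩
    else if h' : j < i then -(X ⟨(j, i), h'⟩)
    else 0


def pf6 {R : Type*} [CommRing R] (x : Fin 6 → Fin 6 → R) : R :=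
  x 0 1 * x 2 3 * x 4 5 - x 0 1 * x 2 4 * x 3 5 + x 0 1 * x 2 5 * x 3 4 - x 0 2 * x 1 3 * x 4 5 + x 0 2 * x 1 4 * x 3 5 - x 0 2 * x 1 5 * x 3 4 + x 0 3 * x 1 2 * x 4 5 - x 0 3 * x 1 4 * x 2 5 + x 0 3 * x 1 5 * x 2 4 - x 0 4 * x 1 2 * x 3 5 + x 0 4 * x 1 3 * x 2 5 - x 0 4 * x 1 5 * x 2 3 + x 0 5 * x 1 2 * x 3 4 - x 0 5 * x 1 3 * x 2 4 + x 0 5 * x 1 4 * x 2 3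

def pf6D {R : Type*} [CommRing R] (x d : Fin 6 → Fin 6 → R) : R :=
  (d 0 1 * x 2 3 * x 4 5 + x 0 1 * d 2 3 * x 4 5 + x 0 1 * x 2 3 * d 4 5)
    - (d 0 1 * x 2 4 * x 3 5 + x 0 1 * d 2 4 * x 3 5 + x 0 1 * x 2 4 * d 3 5)
    + (d 0 1 * x 2 5 * x 3 4 + x 0 1 * d 2 5 * x 3 4 + x 0 1 * x 2 5 * d 3 4)
    - (d 0 2 * x 1 3 * x 4 5 + x 0 2 * d 1 3 * x 4 5 + x 0 2 * x 1 3 * d 4 5)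
    + (d 0 2 * x 1 4 * x 3 5 + x 0 2 * d 1 4 * x 3 5 + x 0 2 * x 1 4 * d 3 5)
    - (d 0 2 * x 1 5 * x 3 4 + x 0 2 * d 1 5 * x 3 4 + x 0 2 * x 1 5 * d 3 4)
    + (d 0 3 * x 1 2 * x 4 5 + x 0 3 * d 1 2 * x 4 5 + x 0 3 * x 1 2 * d 4 5)
    - (d 0 3 * x 1 4 * x 2 5 + x 0 3 * d 1 4 * x 2 5 + x 0 3 * x 1 4 * d 2 5)
    + (d 0 3 * x 1 5 * x 2 4 + x 0 3 * d 1 5 * x 2 4 + x 0 3 * x 1 5 * d 2 4)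
    - (d 0 4 * x 1 2 * x 3 5 + x 0 4 * d 1 2 * x 3 5 + x 0 4 * x 1 2 * d 3 5)
    + (d 0 4 * x 1 3 * x 2 5 + x 0 4 * d 1 3 * x 2 5 + x 0 4 * x 1 3 * d 2 5)
    - (d 0 4 * x 1 5 * x 2 3 + x 0 4 * d 1 5 * x 2 3 + x 0 4 * x 1 5 * d 2 3)
    + (d 0 5 * x 1 2 * x 3 4 + x 0 5 * d 1 2 * x 3 4 + x 0 5 * x 1 2 * d 3 4)
    - (d 0 5 * x 1 3 * x 2 4 + x 0 5 * d 1 3 * x 2 4 + x 0 5 * x 1 3 * d 2 4)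
    + (d 0 5 * x 1 4 * x 2 3 + x 0 5 * d 1 4 * x 2 3 + x 0 5 * x 1 4 * d 2 3)

def pf4 {R : Type*} [CommRing R] {m : ℕ} (x : Fin m → Fin m → R) (i j k l : Fin m) : R :=
  x i j * x k l - x i k * x j l + x i l * x j k

set_option maxRecDepth 100000 in
theorem det4_aux {R : Type*} [CommRing R] (a b c d e f : R) :
    (!![0,a,b,c; -a,0,d,e; -b,-d,0,f; -c,-e,-f,0]).det = (a*f-b*e+c*d)*(a*f-b*e+c*d) := by
  simp [Matrix.det_succ_row_zero, Fin.sum_univ_succ, Fin.succAbove]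
  ring

set_option maxRecDepth 100000 in
set_option maxHeartbeats 4000000 in
theorem det6_aux {R : Type*} [CommRing R] (a b c d e f g h i j k l m n o : R) :
    (!![0,a,b,c,d,e; -a,0,f,g,h,i; -b,-f,0,j,k,l; -c,-g,-j,0,m,n; -d,-h,-k,-m,0,o;
      -e,-i,-l,-n,-o,0]).det = (a*(j*o-k*n+l*m)-b*(g*o-h*n+i*m)+c*(f*o-h*l+i*k)
        -d*(f*n-g*l+i*j)+e*(f*m-g*k+h*j))^2 := by
  simp [Matrix.det_succ_row_zero, Fin.sum_univ_succ, Fin.succAbove]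
  ring

theorem det6_eq {R : Type*} [CommRing R] (x : Matrix (Fin 6) (Fin 6) R)
    (h : ∀ i j, i < j → x j i = - x i j) (h0 : ∀ i, x i i = 0) :
    x.det = pf6 x * pf6 x := by
  have e : x = !![0, x 0 1, x 0 2, x 0 3, x 0 4, x 0 5; -x 0 1, 0, x 1 2, x 1 3, x 1 4, x 1 5;
      -x 0 2, -x 1 2, 0, x 2 3, x 2 4, x 2 5; -x 0 3, -x 1 3, -x 2 3, 0, x 3 4, x 3 5;
      -x 0 4, -x 1 4, -x 2 4, -x 3 4, 0, x 4 5; -x 0 5, -x 1 5, -x 2 5, -x 3 5, -x 4 5, 0] := by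
    ext i j
    fin_cases i <;> fin_cases j <;> first | exact h0 _ | rfl | exact h _ _ (by decide)
  have e' := congrArg Matrix.det e
  rw [det6_aux] at e'
  rw [e']
  unfold pf6
  ring

theorem det4_eq {R : Type*} [CommRing R] {m : ℕ} (x : Matrix (Fin m) (Fin m) R)
    (h : ∀ i j, x j i = - x i j) (h0 : ∀ i, x i i = 0) (i j k l : Fin m) :
    (x.submatrix ![i,j,k,l] ![i,j,k,l]).det = pf4 x i j k l * pf4 x i j k l := by
  have e : x.submatrix ![i,j,k,l] ![i,j,k,l] = !![0, x i j, x i k, x i l; -x i j, 0, x j k, x j l;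
      -x i k, -x j k, 0, x k l; -x i l, -x j l, -x k l, 0] := by
    ext a b
    fin_cases a <;> fin_cases b <;> first | exact h0 _ | rfl | exact h _ _
  rw [e, det4_aux]
  rfl

theorem pf4_of_rank (A : Matrix (Fin 6) (Fin 6) ℂ) (h : ∀ i j, A j i = - A i j)
    (h0 : ∀ i, A i i = 0) (hr : A.rank ≤ 2) (i j k l : Fin 6) : pf4 A i j k l = 0 := by
  by_contra hne
  have hu : IsUnit (A.submatrix ![i,j,k,l] ![i,j,k,l]) := by
    rw [Matrix.isUnit_iff_isUnit_det, det4_eq A h h0, isUnit_iff_ne_zero]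
    exact mul_ne_zero hne hne
  have h1 := Matrix.rank_of_isUnit _ hu
  have h2 := Matrix.rank_submatrix_le A ![i,j,k,l] ![i,j,k,l]
  simp only [Fintype.card_fin] at h1
  omega

theorem rank_of_pf4 (A : Matrix (Fin 6) (Fin 6) ℂ) (h : ∀ i j, A j i = - A i j)
    (hp : ∀ i j k l : Fin 6, pf4 A i j k l = 0) : A.rank ≤ 2 := by
  by_cases hA : A = 0
  · simp [hA]
  · have : ∃ i j, A i j ≠ 0 := by
      by_contra! hc
      exact hA (by ext i j; simp [hc])
    obtain ⟨i, j, hij⟩ := this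
    have : A = (Matrix.of fun k (s : Fin 2) => ![(A i j)⁻¹ * A i k, - (A i j)⁻¹ * A j k] s) *
        (Matrix.of fun (s : Fin 2) l => ![A j l, A i l] s) := by
      ext k l
      have := hp i j k l
      simp only [pf4] at this
      simp [Matrix.mul_apply, Fin.sum_univ_two]
      field_simp
      linear_combination this
    rw [this]
    refine (Matrix.rank_mul_le_left _ _).trans ?_
    refine (Matrix.rank_le_width _)

def mkIdx (i j : Fin 6) (h : i < j) : SkewIdx 3 := ⟨(i, j), h⟩

def pt (A : Matrix (Fin 6) (Fin 6) ℂ) (w : SkewIdx 3) : ℂ := A w.1.1 w.1.2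

noncomputable def gen (k l : Fin 6) : MvPolynomial (SkewIdx 3) ℂ := genSkew 3 k l

theorem gen_lt (k l : Fin 6) (h : k < l) : gen k l = X (mkIdx k l h) := dif_pos h

theorem gen_gt (k l : Fin 6) (h : k < l) : gen l k = - X (mkIdx k l h) :=
  (dif_neg h.not_gt).trans (dif_pos h)

theorem gen_self (k : Fin 6) : gen k k = 0 :=
  (dif_neg (lt_irrefl k)).trans (dif_neg (lt_irrefl k))

theorem pderiv_gen (i j : Fin 6) (h : i < j) (k l : Fin 6) (h' : k < l) :
    pderiv (mkIdx i j h) (gen k l) = if k = i ∧ l = j then 1 else 0 := by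
  classical
  rw [gen_lt k l h', pderiv_X, Pi.single_apply]
  refine if_congr ?_ rfl rfl
  constructor
  · intro e
    have := congrArg Subtype.val e
    exact Prod.mk.inj this
  · rintro ⟨rfl, rfl⟩; rfl

theorem eval_gen (A : Matrix (Fin 6) (Fin 6) ℂ) (k l : Fin 6) (h' : k < l) :
    MvPolynomial.eval (pt A) (gen k l) = A k l := by
  rw [gen_lt k l h', eval_X]; rfl

theorem det_gen : (genSkew 3).det = pf6 gen * pf6 gen := by
  apply det6_eq (genSkew 3)
  · intro i j h
    exact (gen_gt i j h).trans (congrArg Neg.neg (gen_lt i j h).symm)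
  · exact gen_self

theorem deriv_formula (A : Matrix (Fin 6) (Fin 6) ℂ) (i j : Fin 6) (h : i < j) :
    MvPolynomial.eval (pt A)
      (pderiv (mkIdx i j h) (pf6 gen)) =
    pf6D A (fun k l => if k = i ∧ l = j then 1 else 0) := by
  have hg : ∀ k l : Fin 6, k < l → MvPolynomial.eval (pt A)
      (pderiv (mkIdx i j h) (gen k l)) = if k = i ∧ l = j then 1 else 0 := by
    intro k l hkl
    rw [pderiv_gen i j h k l hkl]
    split_ifs <;> simp
  simp only [pf6, pf6D, map_add, map_sub, Derivation.leibniz, smul_eq_mul, map_mul]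
  rw [hg 0 1 (by decide), eval_gen A 0 1 (by decide),
    hg 0 2 (by decide), eval_gen A 0 2 (by decide),
    hg 0 3 (by decide), eval_gen A 0 3 (by decide),
    hg 0 4 (by decide), eval_gen A 0 4 (by decide),
    hg 0 5 (by decide), eval_gen A 0 5 (by decide),
    hg 1 2 (by decide), eval_gen A 1 2 (by decide),
    hg 1 3 (by decide), eval_gen A 1 3 (by decide),
    hg 1 4 (by decide), eval_gen A 1 4 (by decide),
    hg 1 5 (by decide), eval_gen A 1 5 (by decide),
    hg 2 3 (by decide), eval_gen A 2 3 (by decide),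
    hg 2 4 (by decide), eval_gen A 2 4 (by decide),
    hg 2 5 (by decide), eval_gen A 2 5 (by decide),
    hg 3 4 (by decide), eval_gen A 3 4 (by decide),
    hg 3 5 (by decide), eval_gen A 3 5 (by decide),
    hg 4 5 (by decide), eval_gen A 4 5 (by decide)]
  ring

theorem pderiv_zero (A : Matrix (Fin 6) (Fin 6) ℂ)
    (hp : ∀ i j k l : Fin 6, pf4 A i j k l = 0) (i j : Fin 6) (hij : i < j) :
    MvPolynomial.eval (pt A)
      (pderiv (mkIdx i j hij) (pf6 gen)) = 0 := by
  rw [deriv_formula]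
  generalize (fun k l : Fin 6 => (if k = i ∧ l = j then (1 : ℂ) else 0)) = d
  simp only [pf4] at hp
  simp only [pf6D]
  linear_combination d 0 1 * hp 2 3 4 5
    - d 0 2 * hp 1 3 4 5
    + d 0 3 * hp 1 2 4 5
    - d 0 4 * hp 1 2 3 5
    + d 0 5 * hp 1 2 3 4
    + d 1 2 * hp 0 3 4 5
    - d 1 3 * hp 0 2 4 5
    + d 1 4 * hp 0 2 3 5
    - d 1 5 * hp 0 2 3 4
    + d 2 3 * hp 0 1 4 5
    - d 2 4 * hp 0 1 3 5
    + d 2 5 * hp 0 1 3 4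
    + d 3 4 * hp 0 1 2 5
    - d 3 5 * hp 0 1 2 4
    + d 4 5 * hp 0 1 2 3

theorem pf4_all (A : Matrix (Fin 6) (Fin 6) ℂ) (h : ∀ i j, A j i = - A i j)
    (h0 : ∀ i, A i i = 0)
    (H : ∀ (i j : Fin 6) (hij : i < j),
      MvPolynomial.eval (pt A)
      (pderiv (mkIdx i j hij) (pf6 gen)) = 0)
    (i j k l : Fin 6) : pf4 A i j k l = 0 := by
  simp only [deriv_formula, pf6D] at H
  have s1 : ∀ i j k l, pf4 A j i k l = - pf4 A i j k l := by
    intro i j k l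
    simp only [pf4]; rw [h i j]; ring
  have s2 : ∀ i j k l, pf4 A i k j l = - pf4 A i j k l := by
    intro i j k l
    simp only [pf4]; rw [h j k]; ring
  have s3 : ∀ i j k l, pf4 A i j l k = - pf4 A i j k l := by
    intro i j k l
    simp only [pf4]; rw [h k l]; ring
  have e1 : ∀ i k l, pf4 A i i k l = 0 := by
    intro i k l
    simp only [pf4, h0]; ring
  have e2 : ∀ i k l, pf4 A i k k l = 0 := by
    intro i k l
    simp only [pf4, h0]; ring
  have e3 : ∀ i k l, pf4 A i k l l = 0 := by
    intro i k l
    simp only [pf4, h0]; ring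
  have main : ∀ i j k l : Fin 6, i < j → j < k → k < l → pf4 A i j k l = 0 := by
    intro i j k l hij hjk hkl
    have H45 : pf4 A 0 1 2 3 = 0 := by
      have := H 4 5 (by decide)
      simp at this
      simp only [pf4]
      linear_combination this
    have H35 : pf4 A 0 1 2 4 = 0 := by
      have := H 3 5 (by decide)
      simp at this
      simp only [pf4]
      linear_combination -this
    have H34 : pf4 A 0 1 2 5 = 0 := by
      have := H 3 4 (by decide)
      simp at this
      simp only [pf4]
      linear_combination this
    have H25 : pf4 A 0 1 3 4 = 0 := by
      have := H 2 5 (by decide)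
      simp at this
      simp only [pf4]
      linear_combination this
    have H24 : pf4 A 0 1 3 5 = 0 := by
      have := H 2 4 (by decide)
      simp at this
      simp only [pf4]
      linear_combination -this
    have H23 : pf4 A 0 1 4 5 = 0 := by
      have := H 2 3 (by decide)
      simp at this
      simp only [pf4]
      linear_combination this
    have H15 : pf4 A 0 2 3 4 = 0 := by
      have := H 1 5 (by decide)
      simp at this
      simp only [pf4]
      linear_combination -this
    have H14 : pf4 A 0 2 3 5 = 0 := by
      have := H 1 4 (by decide)
      simp at this
      simp only [pf4]
      linear_combination this
    have H13 : pf4 A 0 2 4 5 = 0 := by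
      have := H 1 3 (by decide)
      simp at this
      simp only [pf4]
      linear_combination -this
    have H12 : pf4 A 0 3 4 5 = 0 := by
      have := H 1 2 (by decide)
      simp at this
      simp only [pf4]
      linear_combination this
    have H05 : pf4 A 1 2 3 4 = 0 := by
      have := H 0 5 (by decide)
      simp at this
      simp only [pf4]
      linear_combination this
    have H04 : pf4 A 1 2 3 5 = 0 := by
      have := H 0 4 (by decide)
      simp at this
      simp only [pf4]
      linear_combination -this
    have H03 : pf4 A 1 2 4 5 = 0 := by
      have := H 0 3 (by decide)
      simp at this
      simp only [pf4]
      linear_combination this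
    have H02 : pf4 A 1 3 4 5 = 0 := by
      have := H 0 2 (by decide)
      simp at this
      simp only [pf4]
      linear_combination -this
    have H01 : pf4 A 2 3 4 5 = 0 := by
      have := H 0 1 (by decide)
      simp at this
      simp only [pf4]
      linear_combination this
    fin_cases i <;> fin_cases j <;> first | (exfalso; revert hij; decide) | skip
    all_goals fin_cases k <;> first | (exfalso; revert hjk; decide) | skip
    all_goals fin_cases l <;> first | (exfalso; revert hkl; decide) | assumption
  have m1 : ∀ i j k l : Fin 6, j < k → k < l → pf4 A i j k l = 0 := by
    intro i j k l hjk hkl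
    rcases lt_trichotomy i j with c | c | c
    · exact main _ _ _ _ c hjk hkl
    · rw [c, e1]
    · rw [s1, neg_eq_zero]
      rcases lt_trichotomy i k with c' | c' | c'
      · exact main _ _ _ _ c c' hkl
      · rw [c', e2]
      · rw [s2, neg_eq_zero]
        rcases lt_trichotomy i l with c'' | c'' | c''
        · exact main _ _ _ _ hjk c' c''
        · rw [c'', e3]
        · rw [s3, neg_eq_zero]
          exact main _ _ _ _ hjk hkl c''
  have m2 : ∀ i j k l : Fin 6, k < l → pf4 A i j k l = 0 := by
    intro i j k l hkl
    rcases lt_trichotomy j k with c | c | c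
    · exact m1 _ _ _ _ c hkl
    · rw [c, e2]
    · rw [s2, neg_eq_zero]
      rcases lt_trichotomy j l with c' | c' | c'
      · exact m1 _ _ _ _ c c'
      · rw [c', e3]
      · rw [s3, neg_eq_zero]
        exact m1 _ _ _ _ hkl c'
  rcases lt_trichotomy k l with c | c | c
  · exact m2 _ _ _ _ c
  · rw [c, e3]
  · rw [s3, neg_eq_zero]
    exact m2 _ _ _ _ c

/-- The critical locus of the `6 × 6` Pfaffian is the cone over `Gr(2,6)`: for a
skew-symmetric `6 × 6` complex matrix `A`, all partial derivatives of the Pfaffian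
vanish at `A` if and only if `A` has rank at most `2`. -/
theorem pfaffian_critical_locus (Pf : MvPolynomial (SkewIdx 3) ℂ)
    (hPf : Pf * Pf = (genSkew 3).det)
    (A : Matrix (Fin 6) (Fin 6) ℂ) (hA : Aᵀ = -A) :
    (∀ v : SkewIdx 3,
        MvPolynomial.eval (fun w : SkewIdx 3 => A w.1.1 w.1.2) (MvPolynomial.pderiv v Pf) = 0)
      ↔ A.rank ≤ 2 := by
  have h : ∀ i j, A j i = - A i j := fun i j => by
    simpa using congrFun (congrFun hA i) j
  have h0 : ∀ i, A i i = 0 := fun i => by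
    have := h i i
    exact self_eq_neg.mp this
  have key : (∀ v : SkewIdx 3, MvPolynomial.eval (fun w : SkewIdx 3 => A w.1.1 w.1.2)
      (MvPolynomial.pderiv v Pf) = 0) ↔ (∀ v : SkewIdx 3,
      MvPolynomial.eval (fun w : SkewIdx 3 => A w.1.1 w.1.2)
      (MvPolynomial.pderiv v (pf6 gen)) = 0) := by
    rw [det_gen] at hPf
    rcases mul_self_eq_mul_self_iff.mp hPf with e | e <;> rw [e]
    simp
  rw [key]
  change (∀ v, MvPolynomial.eval (pt A) (pderiv v (pf6 gen)) = 0) ↔ _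
  constructor
  · intro H
    apply rank_of_pf4 A h
    exact pf4_all A h h0 (fun i j hij => H (mkIdx i j hij))
  · intro hr ⟨⟨i, j⟩, hij⟩
    exact pderiv_zero A (pf4_of_rank A h h0 hr) i j hij
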